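/- Let p be a positive integer, τ ∈ ℍ, q = e^{2πiτ}, w = e^{2πis}, y = e^{2πit}, with fractional powers defined by w^{α} := e^{2πiαs}, y^{α} := e^{2πiαt}, q^{α} := e^{2πiατ}. Suppose e^{2πi(s+t)}q^{m} ≠ 1 for all m ∈ ℤ. Then the level-two Appell–Lerch sum at modulus τ/p decomposes into p² Appell–Lerch sums at modulus pτ: A_2((s+t)/p, 2t/p; τ/p) = ∑_{a=0}^{p−1} ∑_{b=0}^{p−1} y^{(2b+a+1−p)/p} w^{(a+1−p)/p} q^{b(b+a+1−p)/p} A_2(s+t+bτ, 2t+(2b+a+1−p)τ; pτ). -/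

import Mathlib

open Complex Finset

/-- `e z = exp(2πi z)`. -/
noncomputable def e (z : ℂ) : ℂ := Complex.exp (2 * Real.pi * Complex.I * z)

/-- The level-two Appell–Lerch sum. -/
noncomputable def A2 (s t τ : ℂ) : ℂ :=
  e s * ∑' n : ℤ, e ((n * (n + 1)) * τ + n * t) / (1 - e (s + n * τ))

lemma e_add (x y : ℂ) : e (x + y) = e x * e y := by
  simp only [e, mul_add, Complex.exp_add]

lemma e_nat_mul (n : ℕ) (x : ℂ) : e (n * x) = e x ^ n := by
  rw [e, e, ← Complex.exp_nat_mul]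
  congr 1
  ring

lemma norm_e (z : ℂ) : ‖e z‖ = Real.exp (-(2 * Real.pi * z.im)) := by
  rw [e, Complex.norm_exp]
  simp [Complex.mul_re, Complex.mul_im]

/-- The Appell–Lerch denominators are bounded away from zero outside a finite set. -/
lemma eventually_half_le_norm_one_sub_e (u τ : ℂ) (hτ : 0 < τ.im) :
    ∀ᶠ n : ℤ in Filter.cofinite, 1 / 2 ≤ ‖1 - e (u + n * τ)‖ := by
  have hnorm (n : ℤ) :
      ‖e (u + n * τ)‖ = Real.exp (-(2 * Real.pi * u.im) + -(2 * Real.pi * τ.im) * n) := by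
    rw [norm_e]
    congr 1
    simp [Complex.mul_im]
    ring
  have hneg : -(2 * Real.pi * τ.im) < 0 := by
    have := Real.pi_pos
    have : 0 < 2 * Real.pi * τ.im := by positivity
    linarith
  rw [Int.cofinite_eq, Filter.eventually_sup]
  constructor
  · have hlim : Filter.Tendsto (fun n : ℤ ↦ ‖e (u + n * τ)‖) Filter.atBot Filter.atTop := by
      simp only [hnorm]
      exact Real.tendsto_exp_atTop.comp (Filter.tendsto_atTop_add_const_left _ _
        ((tendsto_intCast_atBot_iff.2 Filter.tendsto_id).const_mul_atBot_of_neg hneg))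
    filter_upwards [hlim.eventually_ge_atTop (3 / 2)] with n hn
    have := norm_sub_norm_le (e (u + n * τ)) 1
    rw [norm_sub_rev, norm_one] at this
    linarith
  · have hlim : Filter.Tendsto (fun n : ℤ ↦ ‖e (u + n * τ)‖) Filter.atTop (nhds 0) := by
      simp only [hnorm]
      exact Real.tendsto_exp_atBot.comp (Filter.tendsto_atBot_add_const_left _ _
        ((tendsto_intCast_atTop_iff.2 Filter.tendsto_id).const_mul_atTop_of_neg hneg))
    filter_upwards [hlim.eventually_le_const (show (0 : ℝ) < 1 / 2 by norm_num)] with n hn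
    have := norm_sub_norm_le 1 (e (u + n * τ))
    rw [norm_one] at this
    linarith

lemma summable_e_quadratic (c v σ : ℂ) (hσ : 0 < σ.im) :
    Summable fun n : ℤ ↦ e (c + n * v + n ^ 2 * σ) := by
  have hs : Summable (jacobiTheta₂_term · v (2 * σ)) := by
    rw [summable_jacobiTheta₂_term_iff]
    simpa using hσ
  refine (hs.mul_left (e c)).congr fun n ↦ ?_
  rw [jacobiTheta₂_term, e, e, ← Complex.exp_add]
  congr 1
  ring

lemma summable_e_quadratic_div (c v σ u τ : ℂ) (hσ : 0 < σ.im) (hτ : 0 < τ.im) :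
    Summable fun n : ℤ ↦ e (c + n * v + n ^ 2 * σ) / (1 - e (u + n * τ)) := by
  refine Summable.of_norm_bounded_eventually
    ((summable_e_quadratic c v σ hσ).norm.mul_left 2) ?_
  filter_upwards [eventually_half_le_norm_one_sub_e u τ hτ] with n hn
  rw [norm_div, div_le_iff₀ (by linarith)]
  nlinarith [norm_nonneg (e (c + n * v + n ^ 2 * σ))]

/-- A sum over the integers, split into residue classes modulo `p`. -/
lemma tsum_int_eq_sum_range_tsum {f : ℤ → ℂ} (hf : Summable f) (p : ℕ) (hp : 0 < p) :
    ∑' n, f n = ∑ b ∈ range p, ∑' m : ℤ, f (m * p + b) := by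
  have : NeZero p := ⟨hp.ne'⟩
  let φ : Fin p × ℤ ≃ ℤ := (Equiv.prodComm _ _).trans (Int.divModEquiv p).symm
  have hφ (x : Fin p × ℤ) : φ x = x.2 * p + ((x.1 : ℕ) : ℤ) := by
    simp [φ, Int.divModEquiv]
  rw [← φ.tsum_eq f, Summable.tsum_prod (f := fun x ↦ f (φ x)) (φ.summable_iff.2 hf), tsum_fintype,
    ← Fin.sum_univ_eq_sum_range (fun b : ℕ ↦ ∑' m : ℤ, f (m * p + b))]
  simp only [hφ]

lemma one_div_one_sub_eq_sum {x : ℂ} {p : ℕ} (hx : x ^ p ≠ 1) :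
    1 / (1 - x) = ∑ a ∈ range p, x ^ a / (1 - x ^ p) := by
  have hx1 : 1 - x ≠ 0 := fun h0 ↦ hx (by rw [← sub_eq_zero.1 h0, one_pow])
  have hxp : 1 - x ^ p ≠ 0 := sub_ne_zero.2 hx.symm
  rw [← Finset.sum_div, div_eq_div_iff hx1 hxp, one_mul, ← mul_neg_geom_sum x p, mul_comm]

/-- Decomposition of the level-two Appell–Lerch sum at modulus `τ/p` into `p²`
Appell–Lerch sums at modulus `pτ`.  Here `q = e(τ)`, `w = e(s)`, `y = e(t)`, and
fractional powers are interpreted as `w^α = e(αs)`, `y^α = e(αt)`, `q^α = e(ατ)`. -/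
theorem A2_decomposition (p : ℕ) (hp : 0 < p) (τ s t : ℂ) (hτ : 0 < τ.im)
    (h : ∀ m : ℤ, e (s + t + m * τ) ≠ 1) :
    A2 ((s + t) / p) (2 * t / p) (τ / p) =
      ∑ a ∈ Finset.range p, ∑ b ∈ Finset.range p,
        e ((2 * (b : ℂ) + a + 1 - p) / p * t) * e (((a : ℂ) + 1 - p) / p * s) *
          e ((b : ℂ) * ((b : ℂ) + a + 1 - p) / p * τ) *
          A2 (s + t + b * τ) (2 * t + (2 * (b : ℂ) + a + 1 - p) * τ) (p * τ) := by
  have hp0 : (p : ℂ) ≠ 0 := Nat.cast_ne_zero.2 hp.ne'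
  let F (a : ℕ) (n : ℤ) : ℂ :=
    e ((a + 1) * (s + t) / p + n * ((2 * t + (a + 1) * τ) / p) + n ^ 2 * (τ / p)) /
      (1 - e (s + t + n * τ))
  have hF (a : ℕ) : Summable (F a) := by
    refine summable_e_quadratic_div _ _ _ _ _ ?_ hτ
    rw [Complex.div_natCast_im]
    positivity
  have hleft (n : ℤ) : e ((s + t) / p) *
      (e ((n * (n + 1)) * (τ / p) + n * (2 * t / p)) / (1 - e ((s + t) / p + n * (τ / p)))) =
      ∑ a ∈ range p, F a n := by
    have hpow : e ((s + t) / p + n * (τ / p)) ^ p = e (s + t + n * τ) := by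
      rw [← e_nat_mul]
      congr 1
      field_simp
    rw [div_eq_mul_one_div (e _) (1 - _), one_div_one_sub_eq_sum (p := p) (hpow ▸ h n), hpow,
      Finset.mul_sum, Finset.mul_sum]
    refine Finset.sum_congr rfl fun a _ ↦ ?_
    rw [← mul_assoc, ← mul_div_assoc, ← e_nat_mul, ← e_add, ← e_add]
    congr 2
    ring
  rw [A2, ← tsum_mul_left, tsum_congr hleft, Summable.tsum_finsetSum fun a _ ↦ hF a]
  refine Finset.sum_congr rfl fun a _ ↦ ?_
  rw [tsum_int_eq_sum_range_tsum (hF a) p hp]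
  refine Finset.sum_congr rfl fun b _ ↦ ?_
  rw [A2, ← mul_assoc, ← tsum_mul_left]
  refine tsum_congr fun m ↦ ?_
  simp only [F]
  rw [← e_add, ← e_add, ← e_add, ← mul_div_assoc (e _), ← e_add]
  refine congrArg₂ (· / ·) (congrArg e ?_) (congrArg (1 - e ·) ?_)
  · push_cast
    field_simp
    ring
  · push_cast
    ring
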